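/- Let A be a homotopy cut-set for paths α, β : [0,1] → X, i.e., A ⊆ [0,1] is closed, nowhere dense, contains {0,1}, α|_A = β|_A, and for every connected component (a,b) of [0,1] \ A the restrictions α|_{[a,b]} and β|_{[a,b]} are path-homotopic. If for every point t ∈ A, the point α(t) is not in aw(X) (i.e., there is no null sequence of non-null-homotopic loops based at α(t)), then α and β are path-homotopic. -/

import Mathlib

open unitInterval

variable {X : Type*} [TopologicalSpace X]

noncomputable def subpath (α : C(ℝ, X)) (a b : ℝ) : Path (α a) (α b) where
  toFun t := α (a + (t : ℝ) * (b - a))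
  continuous_toFun := α.continuous.comp (by continuity)
  source' := by simp
  target' := by
    show α (a + ((1 : unitInterval) : ℝ) * (b - a)) = α b
    rw [Set.Icc.coe_one, one_mul]
    congr 1
    ring

def HomotopyCutSet (α β : C(ℝ, X)) (A : Set ℝ) : Prop :=
  IsClosed A ∧ IsNowhereDense A ∧ A ⊆ Set.Icc 0 1 ∧ (0:ℝ) ∈ A ∧ (1:ℝ) ∈ A ∧
  Set.EqOn α β A ∧
  ∀ a ∈ A, ∀ b ∈ A, a < b → A ∩ Set.Ioo a b = ∅ →
    ∀ (h1 : α a = β a) (h2 : α b = β b),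
      (subpath α a b).Homotopic ((subpath β a b).cast h1 h2)

def awSet (X : Type*) [TopologicalSpace X] : Set X :=
  {x | ∃ γ : ℕ → Path x x, (∀ n, ¬(γ n).Homotopic (Path.refl x)) ∧
    ∀ U ∈ nhds x, ∀ᶠ n in Filter.atTop, Set.range (γ n) ⊆ U}

def ScatteredSet {Y : Type*} [TopologicalSpace Y] (S : Set Y) : Prop :=
  ∀ T ⊆ S, T.Nonempty → ∃ x ∈ T, ∃ U : Set Y, IsOpen U ∧ U ∩ T = {x}

/-- The straight-line path in `ℝ`. -/
noncomputable def linePath (a b : ℝ) : Path a b where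
  toFun t := a + (t : ℝ) * (b - a)
  continuous_toFun := by fun_prop
  source' := by simp
  target' := by simp

lemma subpath_eq_map {X : Type*} [TopologicalSpace X] (α : C(ℝ, X)) (a b : ℝ) :
    subpath α a b = (linePath a b).map α.continuous := rfl

lemma subpath_trans {X : Type*} [TopologicalSpace X] (α : C(ℝ, X)) (a b c : ℝ) :
    ((subpath α a b).trans (subpath α b c)).Homotopic (subpath α a c) := by
  rw [subpath_eq_map, subpath_eq_map, subpath_eq_map, ← Path.map_trans]
  exact (SimplyConnectedSpace.paths_homotopic _ _).map α

lemma subpath_symm {X : Type*} [TopologicalSpace X] (α : C(ℝ, X)) (a b : ℝ) :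
    ((subpath α a b).symm).Homotopic (subpath α b a) := by
  rw [subpath_eq_map, subpath_eq_map, Path.map_symm]
  exact (SimplyConnectedSpace.paths_homotopic _ _).map α

/-- The restrictions to `[s,t]` are path-homotopic. -/
def CutRel {X : Type*} [TopologicalSpace X] (α β : C(ℝ, X)) (s t : ℝ) : Prop :=
  ∀ (h1 : α s = β s) (h2 : α t = β t),
    (subpath α s t).Homotopic ((subpath β s t).cast h1 h2)

lemma CutRel.trans {X : Type*} [TopologicalSpace X] {α β : C(ℝ, X)} {a b c : ℝ}
    (hb : α b = β b) (h : CutRel α β a b) (h' : CutRel α β b c) : CutRel α β a c := by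
  intro h1 h2
  refine (subpath_trans α a b c).symm.trans (((h h1 hb).hcomp (h' hb h2)).trans ?_)
  rw [← Path.cast_trans]
  exact (subpath_trans β a b c).pathCast h1 h2

lemma CutRel.symm {X : Type*} [TopologicalSpace X] {α β : C(ℝ, X)} {a b : ℝ}
    (h : CutRel α β a b) : CutRel α β b a := by
  intro h1 h2
  refine (subpath_symm α a b).symm.trans ((h h2 h1).symm₂.trans ?_)
  rw [← Path.cast_symm]
  exact (subpath_symm β a b).pathCast h1 h2

lemma homotopic_of_loop {X : Type*} [TopologicalSpace X] {x y : X} (p q : Path x y)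
    (h : (p.trans q.symm).Homotopic (Path.refl x)) : p.Homotopic q := by
  have h1 : (p.trans (q.symm.trans q)).Homotopic p :=
    ((Path.Homotopic.refl p).hcomp (Path.Homotopic.symm_trans q)).trans
      (Path.Homotopic.trans_refl p)
  have h2 : ((p.trans q.symm).trans q).Homotopic q :=
    (h.hcomp (Path.Homotopic.refl q)).trans (Path.Homotopic.refl_trans q)
  exact h1.symm.trans ((Path.Homotopic.trans_assoc p q.symm q).symm.trans h2)

lemma range_subpath {X : Type*} [TopologicalSpace X] (α : C(ℝ, X)) {t s δ : ℝ} {U : Set X}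
    (hU : ∀ r, |r - t| < δ → α r ∈ U) (hs : |s - t| < δ) :
    Set.range (subpath α t s) ⊆ U := by
  rintro _ ⟨r, rfl⟩
  apply hU
  have h0 := r.2.1
  have h1 := r.2.2
  have : t + (r : ℝ) * (s - t) - t = r * (s - t) := by ring
  rw [this, abs_mul, abs_of_nonneg h0]
  nlinarith [abs_nonneg (s - t)]

lemma local_relHom {X : Type*} [TopologicalSpace X] (α β : C(ℝ, X)) (A : Set ℝ)
    (heq : Set.EqOn α β A) {t : ℝ} (ht : t ∈ A) (hw : α t ∉ awSet X) :
    ∃ δ > 0, ∀ s ∈ A, |s - t| < δ → CutRel α β t s := by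
  by_contra! hcon
  have hch : ∀ n : ℕ, ∃ s ∈ A, |s - t| < 1 / ((n : ℝ) + 1) ∧ ¬ CutRel α β t s :=
    fun n => hcon _ (by positivity)
  choose s hsA hst hs using hch
  apply hw
  refine ⟨fun n => (subpath α t (s n)).trans
    ((subpath β t (s n)).cast (heq ht) (heq (hsA n))).symm, ?_, ?_⟩
  · intro n hn
    exact hs n fun _ _ => homotopic_of_loop _ _ hn
  · intro U hU
    have e1 : ∀ᶠ r in nhds t, α r ∈ U := α.continuous.continuousAt hU
    have e2 : ∀ᶠ r in nhds t, β r ∈ U := by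
      apply β.continuous.continuousAt
      rw [← heq ht]; exact hU
    obtain ⟨δ, hδ, hδU⟩ := Metric.eventually_nhds_iff.1 (e1.and e2)
    have hlim := (tendsto_one_div_add_atTop_nhds_zero_nat (𝕜 := ℝ)).eventually (gt_mem_nhds hδ)
    filter_upwards [hlim] with n hn
    have hlt := (hst n).trans hn
    rw [Path.trans_range, Path.symm_range]
    exact Set.union_subset (range_subpath α (fun r hr => (hδU hr).1) hlt)
      (range_subpath β (fun r hr => (hδU hr).2) hlt)

/-- If `A` is a homotopy cut-set for paths `α, β` and `α(t) ∉ aw(X)` for every `t ∈ A`, then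
`α` and `β` are path-homotopic. -/
theorem stmt9 {X : Type*} [TopologicalSpace X] (α β : C(ℝ, X)) (A : Set ℝ)
    (hA : HomotopyCutSet α β A) (hw : ∀ t ∈ A, α t ∉ awSet X) :
    ∀ (h1 : α 0 = β 0) (h2 : α 1 = β 1),
      (subpath α 0 1).Homotopic ((subpath β 0 1).cast h1 h2) := by
  obtain ⟨hcl, -, hsub, h0A, h1A, heq, hgap⟩ := hA
  have hloc := fun t (ht : t ∈ A) => local_relHom α β A heq ht (hw t ht)
  change CutRel α β 0 1
  let S : Set ℝ := {t | t ∈ A ∧ CutRel α β 0 t}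
  have hSne : S.Nonempty := by
    obtain ⟨δ, hδ, h⟩ := hloc 0 h0A
    exact ⟨0, h0A, h 0 h0A (by simpa using hδ)⟩
  have hSbd : BddAbove S := ⟨1, fun t ht => (hsub ht.1).2⟩
  have hcA : sSup S ∈ A :=
    closure_minimal (fun t ht => ht.1) hcl (csSup_mem_closure hSne hSbd)
  set c := sSup S with hc
  obtain ⟨δ, hδ, hcδ⟩ := hloc c hcA
  have hRc : CutRel α β 0 c := by
    obtain ⟨s, hsS, hs⟩ := exists_lt_of_lt_csSup hSne (show c - δ < sSup S by linarith)
    have hle : s ≤ c := le_csSup hSbd hsS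
    refine hsS.2.trans (heq hsS.1) (hcδ s hsS.1 ?_).symm
    rw [abs_lt]; constructor <;> linarith
  rcases (hsub hcA).2.eq_or_lt with h | hlt
  · rw [h] at hRc; exact hRc
  exfalso
  have key : ∀ b ∈ A, c < b → ¬ CutRel α β c b := fun b hb hcb hR =>
    absurd (le_csSup hSbd (show b ∈ S from ⟨hb, hRc.trans (heq hcA) hR⟩)) (not_le.2 hcb)
  let T : Set ℝ := A ∩ Set.Ici (c + δ)
  have hfar : ∀ b ∈ A, c < b → c + δ ≤ b := by
    intro b hb hcb
    by_contra! hlt'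
    exact key b hb hcb (hcδ b hb (by rw [abs_lt]; constructor <;> linarith))
  have hTne : T.Nonempty := ⟨1, h1A, hfar 1 h1A hlt⟩
  have hTbd : BddBelow T := ⟨c + δ, fun t ht => ht.2⟩
  have hbT : sInf T ∈ T := (hcl.inter isClosed_Ici).csInf_mem hTne hTbd
  have hcb : c < sInf T := by
    have : c + δ ≤ sInf T := hbT.2
    linarith
  refine key _ hbT.1 hcb (hgap c hcA _ hbT.1 hcb ?_)
  rw [Set.eq_empty_iff_forall_notMem]
  rintro x ⟨hxA, hx1, hx2⟩
  exact absurd (csInf_le hTbd ⟨hxA, hfar x hxA hx1⟩) (not_le.2 hx2)
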